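/- For a measurable A ⊆ R with |A| > 0, the deficit δ(A) := |(A+A)/2|/|A| − 1 satisfies δ(A) ≥ (1/2)·min{|co(A) \ A|/|A|, 1}. -/

import Mathlib

open scoped Pointwise
open MeasureTheory

/-- A Freiman-type bound: a set of integers with extreme points `0` and `p` has a large sumset. -/
theorem Int.card_add_self_ge_of_prime {p : ℕ} (hp : p.Prime) {S : Finset ℤ}
    (hS : S ⊆ Finset.Icc 0 (p : ℤ)) (h0 : 0 ∈ S) (hpS : (p : ℤ) ∈ S) :
    min p (2 * (S.card - 1) - 1) + (S.card - 1) ≤ (S + S).card := by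
  have : Fact p.Prime := ⟨hp⟩
  have hp0 : (0 : ℤ) < p := by exact_mod_cast hp.pos
  set S' := S.erase (p : ℤ) with hS'
  have hcard : S'.card = S.card - 1 := Finset.card_erase_of_mem hpS
  have hmem : ∀ x ∈ S', x ∈ S ∧ 0 ≤ x ∧ x < p := by
    intro x hx
    obtain ⟨hne, hxS⟩ := Finset.mem_erase.1 hx
    have := Finset.mem_Icc.1 (hS hxS)
    exact ⟨hxS, this.1, lt_of_le_of_ne this.2 hne⟩
  set T : Finset (ZMod p) := S.image (Int.cast) with hT
  have hTcard : S'.card ≤ T.card := by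
    refine Finset.card_le_card_of_injOn (Int.cast) ?_ ?_
    · intro x hx
      exact Finset.mem_image_of_mem _ (hmem x hx).1
    · intro x hx y hy hxy
      have hx := hmem x hx
      have hy := hmem y hy
      have hmod := (ZMod.intCast_eq_intCast_iff x y p).1 hxy
      rwa [Int.ModEq, Int.emod_eq_of_lt hx.2.1 hx.2.2, Int.emod_eq_of_lt hy.2.1 hy.2.2] at hmod
  have hTne : T.Nonempty := ⟨_, Finset.mem_image_of_mem _ h0⟩
  have hCD := ZMod.cauchy_davenport hp hTne hTne
  set Q := S'.image (· + (p : ℤ)) with hQ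
  have hQcard : Q.card = S'.card :=
    Finset.card_image_of_injective _ (add_left_injective _)
  have hQsub : Q ⊆ S + S := by
    intro z hz
    obtain ⟨x, hx, rfl⟩ := Finset.mem_image.1 hz
    exact Finset.add_mem_add (hmem x hx).1 hpS
  have hcover : T + T ⊆ ((S + S) \ Q).image (Int.cast) := by
    intro z hz
    obtain ⟨a, ha, b, hb, rfl⟩ := Finset.mem_add.1 hz
    obtain ⟨x, hx, rfl⟩ := Finset.mem_image.1 ha
    obtain ⟨y, hy, rfl⟩ := Finset.mem_image.1 hb
    rw [Finset.mem_image]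
    by_cases hxy : x + y ∈ Q
    · obtain ⟨w, hw, hwxy⟩ := Finset.mem_image.1 hxy
      refine ⟨w, Finset.mem_sdiff.2 ⟨?_, fun hwQ => ?_⟩, ?_⟩
      · simpa using Finset.add_mem_add (hmem w hw).1 h0
      · obtain ⟨t, ht, htw⟩ := Finset.mem_image.1 hwQ
        have := hmem w hw
        have := hmem t ht
        omega
      · have := congrArg (Int.cast : ℤ → ZMod p) hwxy
        simpa using this
    · exact ⟨x + y, Finset.mem_sdiff.2 ⟨Finset.add_mem_add hx hy, hxy⟩, by push_cast; rfl⟩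
  have h1 := (Finset.card_le_card hcover).trans Finset.card_image_le
  have h2 := Finset.card_sdiff_add_card_eq_card hQsub
  omega

open Filter Topology

/-- A discretisation at scale `(v - u) / p` of the bound on the measure of `K + K`. -/
theorem add_min_le_volume_real_cthickening {K : Set ℝ} (hK : IsCompact K) {u v : ℝ} (huv : u < v)
    (hsub : K ⊆ Set.Icc u v) (hu : u ∈ K) (hv : v ∈ K) {p : ℕ} (hp : p.Prime) :
    min (v - u) (2 * volume.real K - 3 * ((v - u) / p)) + (volume.real K - (v - u) / p)
      ≤ volume.real (Metric.cthickening (2 * ((v - u) / p)) (K + K)) := by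
  have hp0 : (0 : ℝ) < p := by exact_mod_cast hp.pos
  set h := (v - u) / p with hh
  have hpos : 0 < h := div_pos (sub_pos.2 huv) hp0
  have hph : p * h = v - u := by rw [hh]; field_simp
  let n : ℝ → ℤ := fun x => ⌊(x - u) / h⌋
  have hn : ∀ x, u + n x * h ≤ x ∧ x < u + (n x + 1) * h := by
    intro x
    have h1 := Int.floor_le ((x - u) / h)
    have h2 := Int.lt_floor_add_one ((x - u) / h)
    rw [le_div_iff₀ hpos] at h1
    rw [div_lt_iff₀ hpos] at h2
    constructor <;> simp only [n] <;> linarith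
  have hrange : n '' K ⊆ Finset.Icc (0 : ℤ) p := by
    rintro _ ⟨x, hx, rfl⟩
    have hx := hsub hx
    rw [Finset.mem_coe, Finset.mem_Icc]
    constructor
    · exact Int.floor_nonneg.2 (div_nonneg (sub_nonneg.2 hx.1) hpos.le)
    · have : n x ≤ ⌊((p : ℤ) : ℝ)⌋ := Int.floor_le_floor (by
        rw [div_le_iff₀ hpos]; push_cast; rw [hph]; linarith [hx.2])
      simpa using this
  have hfin : (n '' K).Finite := (Finset.finite_toSet _).subset hrange
  set S := hfin.toFinset with hS
  have hmemS : ∀ k, k ∈ S ↔ ∃ x ∈ K, n x = k := by intro k; simp [hS]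
  have hvol : ∀ c (F : Finset ℤ), volume.real (⋃ k ∈ F, Set.Ico (c + k * h) (c + (k + 1) * h))
      = F.card * h := by
    intro c F
    rw [measureReal_biUnion_finset (h := fun k _ => by simp [Real.volume_Ico])]
    · have : ∀ k : ℤ, volume.real (Set.Ico (c + k * h) (c + (k + 1) * h)) = h := by
        intro k
        rw [Real.volume_real_Ico_of_le (by nlinarith)]
        ring
      simp [this]
    · intro k _ l _ hkl
      refine Set.disjoint_left.2 fun x hx hy => hkl ?_
      have h1 : (k : ℝ) < l + 1 := by
        by_contra! hc; nlinarith [hx.1, hy.2, mul_le_mul_of_nonneg_right hc hpos.le]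
      have h2 : (l : ℝ) < k + 1 := by
        by_contra! hc; nlinarith [hx.2, hy.1, mul_le_mul_of_nonneg_right hc hpos.le]
      norm_cast at h1 h2
      omega
    · intro k _
      exact measurableSet_Ico
  have hKS : volume.real K ≤ S.card * h := by
    rw [← hvol u S]
    refine measureReal_mono ?_ ?_
    · intro x hx
      simp only [Set.mem_iUnion]
      exact ⟨n x, (hmemS _).2 ⟨x, hx, rfl⟩, hn x⟩
    · refine (measure_biUnion_lt_top S.finite_toSet fun k _ => ?_).ne
      simp
  have hSS : (S + S).card * h ≤ volume.real (Metric.cthickening (2 * h) (K + K)) := by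
    rw [← hvol (2 * u) (S + S)]
    refine measureReal_mono ?_ ?_
    · intro z hz
      simp only [Set.mem_iUnion] at hz
      obtain ⟨k, hk, hz⟩ := hz
      obtain ⟨a, ha, b, hb, rfl⟩ := Finset.mem_add.1 hk
      obtain ⟨x, hx, rfl⟩ := (hmemS a).1 ha
      obtain ⟨y, hy, rfl⟩ := (hmemS b).1 hb
      refine Metric.mem_cthickening_of_dist_le z (x + y) _ _ (Set.add_mem_add hx hy) ?_
      have hz1 := hz.1
      have hz2 := hz.2
      push_cast at hz1 hz2
      rw [Real.dist_eq, abs_le]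
      constructor <;> nlinarith [hn x, hn y]
    · exact ((hK.add hK).cthickening).measure_lt_top.ne
  have hnv : n v = p := by
    have : (v - u) / h = p := by rw [← hph]; field_simp
    simp [n, this]
  have hdisc := Int.card_add_self_ge_of_prime hp (S := S)
    (fun k hk => hrange (by simpa [hS] using hk)) ((hmemS 0).2 ⟨u, hu, by simp [n]⟩)
    ((hmemS p).2 ⟨v, hv, hnv⟩)
  have hdisc' : min (p : ℝ) (2 * S.card - 3) + (S.card - 1) ≤ ((S + S).card : ℝ) := by
    rcases min_le_iff.1 (le_refl (min p (2 * (S.card - 1) - 1))) with hc | hc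
    · have h1 : p + S.card ≤ (S + S).card + 1 := by omega
      have h2 : (p : ℝ) + S.card ≤ (S + S).card + 1 := by exact_mod_cast h1
      linarith [min_le_left (p : ℝ) (2 * S.card - 3)]
    · have h1 : 2 * S.card + S.card ≤ (S + S).card + 4 := by omega
      have h2 : 2 * (S.card : ℝ) + S.card ≤ (S + S).card + 4 := by exact_mod_cast h1
      linarith [min_le_right (p : ℝ) (2 * S.card - 3)]
  refine le_trans ?_ hSS
  refine le_trans ?_ (mul_le_mul_of_nonneg_right hdisc' hpos.le)
  rw [add_mul, min_mul_of_nonneg _ _ hpos.le, hph]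
  gcongr ?_ + ?_
  · exact min_le_min le_rfl (by linarith)
  · linarith

theorem IsCompact.add_min_le_volume_real_add_self {K : Set ℝ} (hK : IsCompact K) {u v : ℝ}
    (huv : u < v) (hsub : K ⊆ Set.Icc u v) (hu : u ∈ K) (hv : v ∈ K) :
    min (v - u) (2 * volume.real K) + volume.real K ≤ volume.real (K + K) := by
  choose p hpn hp using Nat.exists_infinite_primes
  have hh : Tendsto (fun n => (v - u) / (p n : ℝ)) atTop (𝓝 0) :=
    tendsto_const_nhds.div_atTop (tendsto_natCast_atTop_atTop.comp
      (tendsto_atTop_mono hpn tendsto_id))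
  have hKK : IsCompact (K + K) := hK.add hK
  have hr : Tendsto (fun n => volume.real (Metric.cthickening (2 * ((v - u) / (p n : ℝ))) (K + K)))
      atTop (𝓝 (volume.real (K + K))) := by
    refine (ENNReal.tendsto_toReal hKK.measure_lt_top.ne).comp
      ((tendsto_measure_cthickening_of_isCompact hKK).comp ?_)
    simpa using hh.const_mul 2
  have hl : Tendsto (fun n => min (v - u) (2 * volume.real K - 3 * ((v - u) / (p n : ℝ)))
      + (volume.real K - (v - u) / (p n : ℝ))) atTop
      (𝓝 (min (v - u) (2 * volume.real K) + volume.real K)) := by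
    have h1 := (tendsto_const_nhds (x := v - u)).min
      ((tendsto_const_nhds (x := 2 * volume.real K)).sub (hh.const_mul 3))
    have h2 := (tendsto_const_nhds (x := volume.real K)).sub hh
    simpa using h1.add h2
  exact le_of_tendsto_of_tendsto' hl hr fun n =>
    add_min_le_volume_real_cthickening hK huv hsub hu hv (hp n)

theorem IsCompact.add_min_le_volume_add_self {K : Set ℝ} (hK : IsCompact K) {u v : ℝ}
    (huv : u ≤ v) (hsub : K ⊆ Set.Icc u v) (hu : u ∈ K) (hv : v ∈ K) :
    min (ENNReal.ofReal (v - u)) (2 * volume K) + volume K ≤ volume (K + K) := by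
  rcases huv.eq_or_lt with rfl | huv
  · have : volume K = 0 := measure_mono_null hsub (by simp)
    simp [this]
  · have h := hK.add_min_le_volume_real_add_self huv hsub hu hv
    have hKK := (hK.add hK).measure_lt_top (μ := volume)
    rw [← ENNReal.ofReal_toReal hK.measure_lt_top.ne, ← ENNReal.ofReal_toReal hKK.ne]
    have h2 : (2 : ENNReal) = ENNReal.ofReal 2 := by simp
    rw [h2, ← ENNReal.ofReal_mul zero_le_two, ← ENNReal.ofReal_min,
      ← ENNReal.ofReal_add (le_min (by linarith) (by positivity)) (by positivity)]
    exact ENNReal.ofReal_le_ofReal h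

theorem exists_le_and_exists_ge_of_mem_convexHull {A : Set ℝ} {x : ℝ} (hx : x ∈ convexHull ℝ A) :
    (∃ a ∈ A, a ≤ x) ∧ ∃ a ∈ A, x ≤ a := by
  constructor
  · by_contra! hc
    exact lt_irrefl x (convexHull_min (t := Set.Ioi x) hc (convex_Ioi x) hx)
  · by_contra! hc
    exact lt_irrefl x (convexHull_min (t := Set.Iio x) hc (convex_Iio x) hx)

theorem min_add_le_volume_add_self_of_lt {A : Set ℝ} (hA : MeasurableSet A) {c d : ENNReal}
    (hc : c < volume A) (hd : d < volume (convexHull ℝ A)) :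
    min d (2 * c) + c ≤ volume (A + A) := by
  obtain ⟨K₁, hK₁A, hK₁, hcK₁⟩ := hA.exists_lt_isCompact hc
  obtain ⟨K₂, hK₂A, hK₂, hdK₂⟩ :=
    (convex_convexHull ℝ A).ordConnected.measurableSet.exists_lt_isCompact hd
  have hK : IsCompact (K₁ ∪ K₂) := hK₁.union hK₂
  have hne : (K₁ ∪ K₂).Nonempty := by
    refine (nonempty_of_measure_ne_zero (μ := volume) (s := K₁) ?_).inl
    exact (pos_of_gt hcK₁).ne'
  have hKA : K₁ ∪ K₂ ⊆ convexHull ℝ A :=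
    Set.union_subset (hK₁A.trans (subset_convexHull ℝ A)) hK₂A
  obtain ⟨s, hs, hsmin⟩ := hK.exists_isLeast hne
  obtain ⟨t, ht, htmax⟩ := hK.exists_isGreatest hne
  obtain ⟨u, huA, hus⟩ := (exists_le_and_exists_ge_of_mem_convexHull (hKA hs)).1
  obtain ⟨v, hvA, htv⟩ := (exists_le_and_exists_ge_of_mem_convexHull (hKA ht)).2
  have huv : u ≤ v := hus.trans ((hsmin ht).trans htv)
  have hIcc : K₁ ∪ K₂ ⊆ Set.Icc u v := fun x hx =>
    ⟨hus.trans (hsmin hx), (htmax hx).trans htv⟩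
  set K := insert u (insert v K₁) with hKdef
  have hKsub : K ⊆ A := by
    simp [hKdef, Set.insert_subset_iff, huA, hvA, hK₁A]
  have hmain := ((hK₁.insert v).insert u).add_min_le_volume_add_self huv
    (by simp only [Set.insert_subset_iff, Set.left_mem_Icc, Set.right_mem_Icc]
        exact ⟨huv, huv, Set.subset_union_left.trans hIcc⟩)
    (by simp) (by simp)
  have hcK : c ≤ volume K := hcK₁.le.trans (measure_mono (by
    rw [hKdef]; exact (Set.subset_insert _ _).trans (Set.subset_insert _ _)))
  have hdK : d ≤ ENNReal.ofReal (v - u) := by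
    rw [← Real.volume_Icc]
    exact hdK₂.le.trans (measure_mono (Set.subset_union_right.trans hIcc))
  calc min d (2 * c) + c ≤ min (ENNReal.ofReal (v - u)) (2 * volume K) + volume K := by gcongr
    _ ≤ volume (K + K) := hmain
    _ ≤ volume (A + A) := measure_mono (Set.add_subset_add hKsub hKsub)

theorem min_add_le_volume_add_self {A : Set ℝ} (hA : MeasurableSet A) (hpos : 0 < volume A) :
    min (volume (convexHull ℝ A)) (2 * volume A) + volume A ≤ volume (A + A) := by
  have hpos' : 0 < volume (convexHull ℝ A) :=
    hpos.trans_le (measure_mono (subset_convexHull ℝ A))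
  have := nhdsLT_neBot_of_exists_lt ⟨_, hpos⟩
  have := nhdsLT_neBot_of_exists_lt ⟨_, hpos'⟩
  have hc : Tendsto (fun x : ENNReal × ENNReal => x.1)
      (𝓝[<] volume A ×ˢ 𝓝[<] volume (convexHull ℝ A)) (𝓝 (volume A)) :=
    (tendsto_fst).mono_right nhdsWithin_le_nhds
  have hd : Tendsto (fun x : ENNReal × ENNReal => x.2)
      (𝓝[<] volume A ×ˢ 𝓝[<] volume (convexHull ℝ A)) (𝓝 (volume (convexHull ℝ A))) :=
    (tendsto_snd).mono_right nhdsWithin_le_nhds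
  refine le_of_tendsto ((hd.min (ENNReal.Tendsto.const_mul hc (Or.inr (by simp)))).add hc) ?_
  filter_upwards [prod_mem_prod self_mem_nhdsWithin self_mem_nhdsWithin] with x hx
  exact min_add_le_volume_add_self_of_lt hA hx.1 hx.2

theorem one_dim_deficit_stability (A : Set ℝ) (hA : MeasurableSet A)
    (hpos : 0 < volume A) :
    volume A + min (volume (convexHull ℝ A \ A)) (volume A) / 2
      ≤ volume ((2⁻¹ : ℝ) • (A + A)) := by
  have h := min_add_le_volume_add_self hA hpos
  have hco : volume (convexHull ℝ A) = volume A + volume (convexHull ℝ A \ A) := by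
    rw [measure_add_sdiff hA.nullMeasurableSet, Set.union_eq_self_of_subset_left
      (subset_convexHull ℝ A)]
  rw [hco, two_mul, min_add_add_left] at h
  have hscale : volume ((2⁻¹ : ℝ) • (A + A)) = volume (A + A) / 2 := by
    rw [Measure.addHaar_smul]
    simp [abs_of_pos, ENNReal.ofReal_inv_of_pos, mul_comm, div_eq_mul_inv]
  rw [hscale, ENNReal.le_div_iff_mul_le (by simp) (by simp), add_mul,
    ENNReal.div_mul_cancel (by simp) (by simp), mul_two]
  refine le_of_eq_of_le ?_ h
  ring
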